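/- arXiv:2411.03780 — 2 statements merged into one kernel-verified Lean document; each statement's English description precedes it below -/
import Mathlib

section
/- Let J ∈ ℝ^{N×N} with N = N_1 + … + N_C be partitioned into blocks J_{p,q} ∈ ℝ^{N_p×N_q}. Suppose: (i) block strict diagonal dominance in the ℓ2 sense: for every ℓ ∈ {1,…,C}, σ_min(J_{ℓ,ℓ}) > Σ_{p≠ℓ} σ_max(J_{p,ℓ}); and (ii) for every ℓ, the matrix −J_{ℓ,ℓ} is an M-matrix, i.e., every eigenvalue of −J_{ℓ,ℓ} has nonnegative real part and every off-diagonal entry of −J_{ℓ,ℓ} is nonpositive. Then every eigenvalue of J has strictly negative real part. (This is the paper's Lemma 2 for multi-commodity systems: an equilibrium point whose Jacobian satisfies block strict diagonal dominance and the M-matrix condition is asymptotically stable.) -/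
/-- The smallest singular value `σ_min(M) = sqrt(λ_min(M Mᵀ))`, with
`λ_min(M Mᵀ)` the smallest eigenvalue (real root of the characteristic
polynomial) of the positive semidefinite symmetric matrix `M Mᵀ`. -/
noncomputable def sigmaMin {m n : Type*} [Fintype m] [Fintype n] [DecidableEq m]
    (M : Matrix m n ℝ) : ℝ :=
  Real.sqrt (sInf {r : ℝ | (M * M.transpose).charpoly.IsRoot r})

/-- The largest singular value `σ_max(M) = sqrt(λ_max(Mᵀ M))`, with
`λ_max(Mᵀ M)` the largest eigenvalue (real root of the characteristic
polynomial) of the positive semidefinite symmetric matrix `Mᵀ M`. -/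
noncomputable def sigmaMax {m n : Type*} [Fintype m] [Fintype n] [DecidableEq n]
    (M : Matrix m n ℝ) : ℝ :=
  Real.sqrt (sSup {r : ℝ | (M.transpose * M).charpoly.IsRoot r})

theorem aux_mono {n : Type*} [Fintype n] (M : Matrix n n ℝ)
    (hoff : ∀ i j, i ≠ j → M i j ≤ 0) (u : n → ℝ) (hu : ∀ i, 0 < u i)
    (hMu : ∀ i, 0 < ∑ j, M i j * u j) (x : n → ℝ) (hx : ∀ i, 0 ≤ ∑ j, M i j * x j) :
    ∀ i, 0 ≤ x i := by
  intro k
  have : Nonempty n := ⟨k⟩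
  obtain ⟨i, hi⟩ := Finite.exists_min (fun i => x i / u i)
  by_contra hk
  push Not at hk
  have hc : x i / u i < 0 := lt_of_le_of_lt (hi k) (div_neg_of_neg_of_pos hk (hu k))
  set c := x i / u i with hcdef
  have hy : ∀ j, 0 ≤ x j - c * u j := by
    intro j
    have := hi j
    rw [le_div_iff₀ (hu j)] at this
    linarith
  have hyi : x i - c * u i = 0 := by
    rw [hcdef, div_mul_cancel₀ _ (hu i).ne']; ring
  have h1 : ∑ j, M i j * (x j - c * u j) ≤ 0 := by
    apply Finset.sum_nonpos
    intro j _
    by_cases hij : i = j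
    · subst hij; rw [hyi]; simp
    · exact mul_nonpos_of_nonpos_of_nonneg (hoff i j hij) (hy j)
  have h2 : ∑ j, M i j * (x j - c * u j) = (∑ j, M i j * x j) - c * ∑ j, M i j * u j := by
    rw [Finset.mul_sum, ← Finset.sum_sub_distrib]
    exact Finset.sum_congr rfl fun j _ => by ring
  have h3 := mul_neg_of_neg_of_pos hc (hMu i)
  have h4 := hx i
  linarith

theorem aux_pos {n : Type*} [Fintype n] (M : Matrix n n ℝ)
    (hoff : ∀ i j, i ≠ j → M i j ≤ 0) (u : n → ℝ) (hu : ∀ i, 0 ≤ u i)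
    (hMu : ∀ i, 0 < ∑ j, M i j * u j) : ∀ i, 0 < u i := by
  intro i
  refine lt_of_le_of_ne (hu i) fun h => ?_
  have : ∑ j, M i j * u j ≤ 0 := by
    apply Finset.sum_nonpos
    intro j _
    by_cases hij : i = j
    · subst hij; rw [← h]; simp
    · exact mul_nonpos_of_nonpos_of_nonneg (hoff i j hij) (hu j)
  exact absurd (hMu i) (not_lt.mpr this)

/-- existence of a positive vector mapped to a positive vector -/
theorem aux_exists {n : Type*} [Fintype n] [DecidableEq n] (B : Matrix n n ℝ)
    (hoff : ∀ i j, i ≠ j → B i j ≤ 0)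
    (hdet : ∀ t : ℝ, 0 ≤ t → (B + t • (1 : Matrix n n ℝ)).det ≠ 0) :
    ∃ u : n → ℝ, (∀ i, 0 < u i) ∧ ∀ i, 0 < ∑ j, B i j * u j := by
  cases isEmpty_or_nonempty n with
  | inl h => exact ⟨fun _ => 1, fun i => isEmptyElim i, fun i => isEmptyElim i⟩
  | inr h =>
  let Mt : ℝ → Matrix n n ℝ := fun t => B + t • (1 : Matrix n n ℝ)
  have hMoff : ∀ t, ∀ i j, i ≠ j → Mt t i j ≤ 0 := by
    intro t i j hij
    simp [Mt, Matrix.one_apply_ne hij, hoff i j hij]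
  let u : ℝ → n → ℝ := fun t => (Mt t)⁻¹.mulVec (fun _ => 1)
  have hu : ∀ t, 0 ≤ t → ∀ i, ∑ j, Mt t i j * u t j = 1 := by
    intro t ht i
    have : (Mt t).mulVec (u t) = fun _ => 1 := by
      simp only [u]
      rw [Matrix.mulVec_mulVec, Matrix.mul_nonsing_inv _ (isUnit_iff_ne_zero.mpr (hdet t ht)),
        Matrix.one_mulVec]
    exact congrFun this i
  have hMc : Continuous Mt := by
    simp only [Mt]; fun_prop
  have hcont : ContinuousOn u (Set.Ici 0) := by
    simp only [u, Matrix.inv_def, Ring.inverse_eq_inv']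
    refine continuousOn_pi.mpr fun i => ?_
    simp only [Matrix.mulVec, dotProduct, Matrix.smul_apply, smul_eq_mul]
    refine continuousOn_finsetSum _ fun j _ => ?_
    refine ContinuousOn.mul (ContinuousOn.mul (ContinuousOn.inv₀ ?_ ?_) ?_) continuousOn_const
    · exact hMc.matrix_det.continuousOn
    · intro t ht; exact hdet t ht
    · exact (hMc.matrix_adjugate.matrix_elem i j).continuousOn
  let g : ℝ → ℝ := fun t => Finset.univ.inf' Finset.univ_nonempty (fun i => u t i)
  have hgc : ContinuousOn g (Set.Ici 0) := by
    simp only [g]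
    exact ContinuousOn.finset_inf'_apply _ fun i _ => (continuousOn_pi.mp hcont i)
  have hpos : ∀ t, 0 ≤ t → 0 ≤ g t → ∀ i, 0 < u t i := by
    intro t ht hg
    refine aux_pos (Mt t) (hMoff t) (u t) ?_ (fun i => by rw [hu t ht i]; norm_num)
    intro i
    exact hg.trans (Finset.inf'_le _ (Finset.mem_univ i))
  have hne : ∀ t, 0 ≤ t → g t ≠ 0 := by
    intro t ht h0
    have h1 := hpos t ht h0.ge
    have : 0 < g t := by
      simp only [g]
      rw [Finset.lt_inf'_iff]
      exact fun i _ => h1 i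
    exact this.ne' h0
  obtain ⟨T, hT0, hT⟩ : ∃ T : ℝ, 0 ≤ T ∧ ∀ i, 0 < ∑ j, Mt T i j * 1 := by
    refine ⟨1 + ∑ i, |∑ j, B i j|, by positivity, fun i => ?_⟩
    have h1 : |∑ j, B i j| ≤ ∑ i, |∑ j, B i j| :=
      Finset.single_le_sum (f := fun i => |∑ j, B i j|) (fun _ _ => abs_nonneg _)
        (Finset.mem_univ i)
    have h2 := neg_abs_le (∑ j, B i j)
    simp only [Mt, Matrix.add_apply, Matrix.smul_apply, smul_eq_mul, mul_one,
      Finset.sum_add_distrib, ← Finset.mul_sum, Matrix.one_apply, Finset.sum_ite_eq,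
      Finset.mem_univ, if_true]
    linarith
  have hgT : 0 ≤ g T := by
    simp only [g]
    rw [Finset.le_inf'_iff]
    intro i _
    exact aux_mono (Mt T) (hMoff T) (fun _ => 1) (fun _ => one_pos) hT (u T)
      (fun i => by rw [hu T hT0 i]; norm_num) i
  have hg0 : 0 ≤ g 0 := by
    by_contra hneg
    push Not at hneg
    have : (0 : ℝ) ∈ g '' Set.Icc 0 T :=
      intermediate_value_Icc hT0 (hgc.mono Set.Icc_subset_Ici_self) ⟨hneg.le, hgT⟩
    obtain ⟨t, ht, h⟩ := this
    exact hne t ht.1 h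
  refine ⟨u 0, hpos 0 le_rfl hg0, fun i => ?_⟩
  have := hu 0 le_rfl i
  simp only [Mt, zero_smul, add_zero] at this
  rw [this]; norm_num

noncomputable def nrm {n : Type*} [Fintype n] (w : n → ℂ) : ℝ := Real.sqrt (∑ i, ‖w i‖ ^ 2)

theorem nrm_eq {n : Type*} [Fintype n] (w : n → ℂ) : nrm w = ‖(WithLp.toLp 2 w : EuclideanSpace ℂ n)‖ := by
  rw [EuclideanSpace.norm_eq]; rfl

theorem nrm_sum_le {n ι : Type*} [Fintype n] (s : Finset ι) (w : ι → n → ℂ) :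
    nrm (fun i => ∑ p ∈ s, w p i) ≤ ∑ p ∈ s, nrm (w p) := by
  simp only [nrm_eq]
  have : (WithLp.toLp 2 (fun i => ∑ p ∈ s, w p i) : EuclideanSpace ℂ n)
      = ∑ p ∈ s, WithLp.toLp 2 (w p) := by
    ext i; simp
  rw [this]
  exact norm_sum_le _ _

theorem aux_block {n : Type*} [Fintype n] [DecidableEq n] (A : Matrix n n ℝ)
    (hoff : ∀ i j, i ≠ j → A i j ≤ 0)
    (heig : ∀ z : ℂ, (A.map (fun x : ℝ => (x : ℂ))).charpoly.IsRoot z → 0 ≤ z.re)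
    (σ : ℝ) (hσ0 : 0 < σ)
    (hσ : ∀ x : n → ℝ, σ ^ 2 * ∑ i, x i ^ 2 ≤ ∑ j, (∑ i, A i j * x i) ^ 2)
    (w v : n → ℂ) (z : ℂ) (hz : 0 ≤ z.re)
    (h : ∀ j, ∑ i, (A i j : ℂ) * w i + z * w j = v j) : σ * nrm w ≤ nrm v := by
  have hdet0 : A.transpose.det ≠ 0 := by
    intro h0
    obtain ⟨x, hx, hx0⟩ := Matrix.exists_mulVec_eq_zero_iff.mpr h0
    have h1 := hσ x
    have h2 : ∀ j, ∑ i, A i j * x i = 0 := fun j => congrFun hx0 j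
    simp only [h2] at h1
    obtain ⟨k, hk⟩ := Function.ne_iff.mp hx
    have h3 : 0 < ∑ i, x i ^ 2 := 
      Finset.sum_pos' (fun i _ => sq_nonneg _) ⟨k, Finset.mem_univ k, by
        have : x k ≠ 0 := hk
        positivity⟩
    have h4 : 0 < σ ^ 2 * ∑ i, x i ^ 2 := by positivity
    simp at h1
    linarith
  have hdet : ∀ t : ℝ, 0 ≤ t → (A.transpose + t • (1 : Matrix n n ℝ)).det ≠ 0 := by
    intro t ht h0
    rcases ht.eq_or_lt with rfl | ht
    · simp only [zero_smul, add_zero] at h0; exact hdet0 h0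
    have h1 : (A + t • (1 : Matrix n n ℝ)).det = 0 := by
      rw [← Matrix.det_transpose]; simpa using h0
    have h2 := heig (-(t : ℂ)) (by
      rw [Polynomial.IsRoot, Matrix.eval_charpoly]
      have : Matrix.scalar n (-(t : ℂ)) - A.map (fun x : ℝ => (x : ℂ))
          = -((A + t • (1 : Matrix n n ℝ)).map (Complex.ofRealHom)) := by
        ext i j
        by_cases hij : i = j
        · subst hij; simp; ring
        · simp [hij]
      rw [this, Matrix.det_neg]
      have h3 := RingHom.map_det Complex.ofRealHom (A + t • (1 : Matrix n n ℝ))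
      rw [h1] at h3
      have h4 : ((A + t • (1 : Matrix n n ℝ)).map Complex.ofRealHom).det = 0 := by
        rw [map_zero] at h3; exact h3.symm
      rw [h4, mul_zero])
    simp at h2
    linarith
  obtain ⟨u, hu, hBu⟩ := aux_exists A.transpose (fun i j hij => hoff j i hij.symm) hdet
  -- y solves the real system
  let y : n → ℝ := (A.transpose)⁻¹.mulVec (fun j => ‖v j‖)
  have hy : ∀ j, ∑ i, A i j * y i = ‖v j‖ := by
    intro j
    have : (A.transpose).mulVec y = fun j => ‖v j‖ := by
      simp only [y]
      rw [Matrix.mulVec_mulVec, Matrix.mul_nonsing_inv _ (isUnit_iff_ne_zero.mpr hdet0),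
        Matrix.one_mulVec]
    exact congrFun this j
  have hw : ∀ j, ∑ i, A i j * ‖w i‖ ≤ ‖v j‖ := by
    intro j
    have e1 : ((A j j : ℂ) + z) * w j = v j - ∑ i ∈ Finset.univ.erase j, (A i j : ℂ) * w i := by
      rw [← h j, ← Finset.add_sum_erase _ _ (Finset.mem_univ j)]; ring
    have e2 : A j j * ‖w j‖ ≤ ‖((A j j : ℂ) + z) * w j‖ := by
      rw [norm_mul]
      refine mul_le_mul_of_nonneg_right ?_ (norm_nonneg _)
      have := Complex.re_le_norm ((A j j : ℂ) + z)
      simp at this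
      linarith
    have e3 : ‖v j - ∑ i ∈ Finset.univ.erase j, (A i j : ℂ) * w i‖
        ≤ ‖v j‖ + ∑ i ∈ Finset.univ.erase j, (- A i j) * ‖w i‖ := by
      refine (norm_sub_le _ _).trans (add_le_add le_rfl ((norm_sum_le _ _).trans ?_))
      refine Finset.sum_le_sum fun i hi => ?_
      rw [norm_mul, Complex.norm_real, Real.norm_eq_abs,
        abs_of_nonpos (hoff i j (Finset.ne_of_mem_erase hi))]
    rw [← e1] at e3
    rw [← Finset.add_sum_erase _ _ (Finset.mem_univ j)]
    simp only [neg_mul, Finset.sum_neg_distrib] at e3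
    linarith
  have hle : ∀ i, 0 ≤ y i - ‖w i‖ := by
    refine aux_mono A.transpose (fun i j hij => hoff j i hij.symm) u hu hBu _ fun j => ?_
    simp only [Matrix.transpose_apply, mul_sub, Finset.sum_sub_distrib, hy]
    linarith [hw j]
  have h1 := hσ y
  simp only [hy] at h1
  have h2 : ∑ i, ‖w i‖ ^ 2 ≤ ∑ i, y i ^ 2 := 
    Finset.sum_le_sum fun i _ => pow_le_pow_left₀ (norm_nonneg _) (by linarith [hle i]) 2
  unfold nrm
  refine Real.le_sqrt_of_sq_le ?_
  rw [mul_pow, Real.sq_sqrt (by positivity)]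
  exact (mul_le_mul_of_nonneg_left h2 (by positivity)).trans h1

theorem aux_psd {n : Type*} [Fintype n] [DecidableEq n] (K : Matrix n n ℝ) (hK : K.IsHermitian)
    (h : ∀ r : ℝ, ∀ x : n → ℝ, x ≠ 0 → K.mulVec x = r • x → 0 ≤ r) (x : n → ℝ) :
    0 ≤ dotProduct x (K.mulVec x) := by
  have hp : K.PosSemidef := by
    rw [hK.posSemidef_iff_eigenvalues_nonneg]
    intro i
    refine h _ _ ?_ (hK.mulVec_eigenvectorBasis i)
    intro h0
    have h1 := hK.eigenvectorBasis.orthonormal.ne_zero i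
    apply h1
    ext j
    exact congrFun h0 j
  simpa using hp.dotProduct_mulVec_nonneg x

theorem aux_root {n : Type*} [Fintype n] [DecidableEq n] (H : Matrix n n ℝ) (r : ℝ)
    (x : n → ℝ) (hx : x ≠ 0) (h : H.mulVec x = r • x) : H.charpoly.IsRoot r := by
  rw [Polynomial.IsRoot, Matrix.eval_charpoly]
  refine Matrix.exists_mulVec_eq_zero_iff.mp ⟨x, hx, ?_⟩
  rw [Matrix.sub_mulVec, h]
  ext i
  simp [Matrix.scalar_apply]

theorem aux_fin {n : Type*} [Fintype n] [DecidableEq n] (H : Matrix n n ℝ) :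
    {r : ℝ | H.charpoly.IsRoot r}.Finite :=
  Polynomial.finite_setOfPred_isRoot H.charpoly_monic.ne_zero

theorem aux_low {n : Type*} [Fintype n] [DecidableEq n] (H : Matrix n n ℝ) (hH : H.IsHermitian)
    (x : n → ℝ) :
    sInf {r : ℝ | H.charpoly.IsRoot r} * dotProduct x x ≤ dotProduct x (H.mulVec x) := by
  set c := sInf {r : ℝ | H.charpoly.IsRoot r} with hc
  have h1 := aux_psd (H - c • (1 : Matrix n n ℝ)) (by
    refine hH.sub ?_
    simp [Matrix.IsHermitian]) (fun r y hy hr => by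
      have : H.charpoly.IsRoot (r + c) := by
        refine aux_root H _ y hy ?_
        rw [Matrix.sub_mulVec, Matrix.smul_mulVec, Matrix.one_mulVec] at hr
        rw [add_smul, ← hr]; simp
      have := csInf_le (aux_fin H).bddBelow this
      linarith) x
  rw [Matrix.sub_mulVec, Matrix.smul_mulVec, Matrix.one_mulVec, dotProduct_sub,
    dotProduct_smul, smul_eq_mul] at h1
  linarith

theorem aux_up {n : Type*} [Fintype n] [DecidableEq n] (H : Matrix n n ℝ) (hH : H.IsHermitian)
    (x : n → ℝ) :
    dotProduct x (H.mulVec x) ≤ sSup {r : ℝ | H.charpoly.IsRoot r} * dotProduct x x := by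
  set c := sSup {r : ℝ | H.charpoly.IsRoot r} with hc
  have h1 := aux_psd (c • (1 : Matrix n n ℝ) - H) (by
    refine Matrix.IsHermitian.sub ?_ hH
    simp [Matrix.IsHermitian]) (fun r y hy hr => by
      have : H.charpoly.IsRoot (c - r) := by
        refine aux_root H _ y hy ?_
        rw [Matrix.sub_mulVec, Matrix.smul_mulVec, Matrix.one_mulVec] at hr
        rw [sub_smul, ← hr]; simp
      have := le_csSup (aux_fin H).bddAbove this
      linarith) x
  rw [Matrix.sub_mulVec, Matrix.smul_mulVec, Matrix.one_mulVec, dotProduct_sub,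
    dotProduct_smul, smul_eq_mul] at h1
  linarith

theorem dot_self {n : Type*} [Fintype n] (x : n → ℝ) : dotProduct x x = ∑ i, x i ^ 2 := by
  simp [dotProduct, sq]

theorem sigmaMin_low {m n : Type*} [Fintype m] [Fintype n] [DecidableEq m] (M : Matrix m n ℝ)
    (h0 : 0 < sigmaMin M) (x : m → ℝ) :
    sigmaMin M ^ 2 * ∑ i, x i ^ 2 ≤ ∑ j, (∑ i, M i j * x i) ^ 2 := by
  have h1 := aux_low (M * M.transpose) (by
    simpa using Matrix.isHermitian_mul_conjTranspose_self M) x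
  unfold sigmaMin at h0 ⊢
  rw [Real.sq_sqrt (Real.sqrt_pos.mp h0).le]
  rw [← Matrix.mulVec_mulVec, Matrix.dotProduct_mulVec, ← Matrix.mulVec_transpose,
    dot_self, dot_self] at h1
  exact h1

theorem sigmaMax_up {m n : Type*} [Fintype m] [Fintype n] [DecidableEq n] (M : Matrix m n ℝ)
    (x : n → ℝ) :
    dotProduct (M.mulVec x) (M.mulVec x) ≤ sigmaMax M ^ 2 * dotProduct x x := by
  have h1 := aux_up (M.transpose * M) (by
    simpa using Matrix.isHermitian_conjTranspose_mul_self M) x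
  have h2 : sSup {r : ℝ | (M.transpose * M).charpoly.IsRoot r} ≤ sigmaMax M ^ 2 := by
    unfold sigmaMax
    rcases le_total 0 (sSup {r : ℝ | (M.transpose * M).charpoly.IsRoot r}) with h | h
    · rw [Real.sq_sqrt h]
    · exact h.trans (sq_nonneg _)
  rw [← Matrix.mulVec_mulVec, Matrix.dotProduct_mulVec, Matrix.vecMul_transpose] at h1
  have h3 : 0 ≤ dotProduct x x := by rw [dot_self]; positivity
  exact h1.trans (mul_le_mul_of_nonneg_right h2 h3)

theorem sigmaMax_nonneg {m n : Type*} [Fintype m] [Fintype n] [DecidableEq n]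
    (M : Matrix m n ℝ) : 0 ≤ sigmaMax M := Real.sqrt_nonneg _

theorem sigmaMax_up_real {m n : Type*} [Fintype m] [Fintype n] [DecidableEq n] (M : Matrix m n ℝ)
    (x : m → ℝ) : ∑ j, (∑ i, M i j * x i) ^ 2 ≤ sigmaMax M ^ 2 * ∑ i, x i ^ 2 := by
  set y : n → ℝ := M.transpose.mulVec x with hy
  have h1 := sigmaMax_up M y
  have h2 : dotProduct y y = ∑ i, x i * M.mulVec y i := by
    rw [show (∑ i, x i * M.mulVec y i) = dotProduct x (M.mulVec y) from rfl,
      Matrix.dotProduct_mulVec, ← Matrix.mulVec_transpose, Matrix.transpose_transpose,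
      dotProduct_comm]
  have h3 := Finset.sum_mul_sq_le_sq_mul_sq Finset.univ x (M.mulVec y)
  rw [← h2, ← dot_self (M.mulVec y), ← dot_self x] at h3
  rw [← dot_self x]
  change ∑ j, (y j) ^ 2 ≤ _
  rw [← dot_self y]
  have hx0 : 0 ≤ dotProduct x x := by rw [dot_self]; positivity
  have hy0 : 0 ≤ dotProduct y y := by rw [dot_self]; positivity
  have h4 : dotProduct y y ^ 2 ≤ dotProduct x x * (sigmaMax M ^ 2 * dotProduct y y) :=
    h3.trans (mul_le_mul_of_nonneg_left h1 hx0)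
  rcases hy0.eq_or_lt with h | h
  · rw [← h]; positivity
  · refine le_of_mul_le_mul_right ?_ h
    nlinarith

theorem sigmaMax_up_complex {m n : Type*} [Fintype m] [Fintype n] [DecidableEq n]
    (M : Matrix m n ℝ) (w : m → ℂ) :
    nrm (fun j => ∑ i, (M i j : ℂ) * w i) ≤ sigmaMax M * nrm w := by
  have h1 := sigmaMax_up_real M (fun i => (w i).re)
  have h2 := sigmaMax_up_real M (fun i => (w i).im)
  have hs : ∀ z : ℂ, ‖z‖ ^ 2 = z.re ^ 2 + z.im ^ 2 := fun z => by
    rw [Complex.sq_norm, Complex.normSq_apply]; ring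
  unfold nrm
  refine Real.sqrt_le_iff.mpr ⟨mul_nonneg (sigmaMax_nonneg M) (Real.sqrt_nonneg _), ?_⟩
  rw [mul_pow, Real.sq_sqrt (by positivity)]
  simp only [hs, Complex.re_sum, Complex.im_sum, Complex.re_ofReal_mul, Complex.im_ofReal_mul,
    Finset.sum_add_distrib]
  linarith

/-- **Lemma 2.**  Let `J ∈ ℝ^{N×N}`, `N = N₁ + … + N_C`, be partitioned into
blocks `J_{p,q} ∈ ℝ^{N_p × N_q}` (indexed here by the sigma type
`Σ ℓ : Fin C, Fin (Nv ℓ)`).  Suppose (i) block strict diagonal dominance in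
the ℓ2 sense: `σ_min(J_{ℓ,ℓ}) > Σ_{p≠ℓ} σ_max(J_{p,ℓ})` for every `ℓ`; and
(ii) `−J_{ℓ,ℓ}` is an M-matrix for every `ℓ`: all its eigenvalues have
nonnegative real part and all its off-diagonal entries are nonpositive.
Then every eigenvalue of `J` has strictly negative real part. -/
theorem stmt4 {C : ℕ} {Nv : Fin C → ℕ}
    (J : Matrix ((ℓ : Fin C) × Fin (Nv ℓ)) ((ℓ : Fin C) × Fin (Nv ℓ)) ℝ)
    (hdom : ∀ ℓ : Fin C,
      ∑ p ∈ Finset.univ.erase ℓ,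
          sigmaMax (Matrix.of fun (i : Fin (Nv p)) (j : Fin (Nv ℓ)) => J ⟨p, i⟩ ⟨ℓ, j⟩) <
        sigmaMin (Matrix.of fun (i j : Fin (Nv ℓ)) => J ⟨ℓ, i⟩ ⟨ℓ, j⟩))
    (hM_eig : ∀ ℓ : Fin C, ∀ z : ℂ,
      ((-(Matrix.of fun (i j : Fin (Nv ℓ)) => J ⟨ℓ, i⟩ ⟨ℓ, j⟩)).map
          (fun x : ℝ => (x : ℂ))).charpoly.IsRoot z → 0 ≤ z.re)
    (hM_off : ∀ ℓ : Fin C, ∀ i j : Fin (Nv ℓ), i ≠ j → -(J ⟨ℓ, i⟩ ⟨ℓ, j⟩) ≤ 0) :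
    ∀ z : ℂ, (J.map (fun x : ℝ => (x : ℂ))).charpoly.IsRoot z → z.re < 0 := by
  intro z hz
  by_contra hre
  push Not at hre
  rw [Polynomial.IsRoot, Matrix.eval_charpoly] at hz
  obtain ⟨w, hw0, hw⟩ := Matrix.exists_vecMul_eq_zero_iff.mpr hz
  have hE : ∀ (l : Fin C) (j : Fin (Nv l)),
      ∑ p, ∑ i, (J ⟨p, i⟩ ⟨l, j⟩ : ℂ) * w ⟨p, i⟩ = z * w ⟨l, j⟩ := by
    intro l j
    have h1 := congrFun hw ⟨l, j⟩
    rw [Matrix.vecMul_sub] at h1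
    simp only [Pi.sub_apply, Pi.zero_apply, Matrix.scalar_apply, Matrix.vecMul_diagonal] at h1
    have h2 : Matrix.vecMul w (J.map (fun x : ℝ => (x : ℂ))) ⟨l, j⟩
        = ∑ p, ∑ i, (J ⟨p, i⟩ ⟨l, j⟩ : ℂ) * w ⟨p, i⟩ := by
      simp only [Matrix.vecMul, dotProduct, Matrix.map_apply, Fintype.sum_sigma]
      exact Finset.sum_congr rfl fun p _ => Finset.sum_congr rfl fun i _ => mul_comm _ _
    rw [← h2]
    linear_combination -h1
  obtain ⟨⟨k, k'⟩, hk⟩ := Function.ne_iff.mp hw0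
  have : Nonempty (Fin C) := ⟨k⟩
  obtain ⟨l, hl⟩ := Finite.exists_max (fun p : Fin C => nrm (fun i => w ⟨p, i⟩))
  have hpos : 0 < nrm (fun i => w ⟨l, i⟩) := by
    refine lt_of_lt_of_le ?_ (hl k)
    refine Real.sqrt_pos.mpr (Finset.sum_pos' (fun i _ => by positivity)
      ⟨k', Finset.mem_univ _, ?_⟩)
    have : w ⟨k, k'⟩ ≠ 0 := hk
    positivity
  set D := Matrix.of fun (i j : Fin (Nv l)) => J ⟨l, i⟩ ⟨l, j⟩ with hD
  have hσ0 : 0 < sigmaMin D :=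
    lt_of_le_of_lt (Finset.sum_nonneg fun p _ => sigmaMax_nonneg _) (hdom l)
  have hb := aux_block (-D) (fun i j hij => hM_off l i j hij) (hM_eig l) (sigmaMin D) hσ0
    (fun x => by
      have := sigmaMin_low D hσ0 x
      simpa [Finset.sum_neg_distrib] using this)
    (fun i => w ⟨l, i⟩)
    (fun j => ∑ p ∈ Finset.univ.erase l, ∑ i, (J ⟨p, i⟩ ⟨l, j⟩ : ℂ) * w ⟨p, i⟩) z hre
    (fun j => by
      have h1 := hE l j
      rw [← Finset.add_sum_erase _ _ (Finset.mem_univ l)] at h1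
      simp only [hD, Matrix.neg_apply, Matrix.of_apply, Complex.ofReal_neg, neg_mul,
        Finset.sum_neg_distrib]
      linear_combination -h1)
  have hv := nrm_sum_le (Finset.univ.erase l)
    (fun p (j : Fin (Nv l)) => ∑ i, (J ⟨p, i⟩ ⟨l, j⟩ : ℂ) * w ⟨p, i⟩)
  have hv2 : ∑ p ∈ Finset.univ.erase l,
      nrm (fun (j : Fin (Nv l)) => ∑ i, (J ⟨p, i⟩ ⟨l, j⟩ : ℂ) * w ⟨p, i⟩)
      ≤ ∑ p ∈ Finset.univ.erase l,
        sigmaMax (Matrix.of fun (i : Fin (Nv p)) (j : Fin (Nv l)) => J ⟨p, i⟩ ⟨l, j⟩)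
          * nrm (fun i => w ⟨l, i⟩) := by
    refine Finset.sum_le_sum fun p _ => ?_
    exact (sigmaMax_up_complex (Matrix.of fun (i : Fin (Nv p)) (j : Fin (Nv l)) =>
      J ⟨p, i⟩ ⟨l, j⟩) (fun i => w ⟨p, i⟩)).trans
      (mul_le_mul_of_nonneg_left (hl p) (sigmaMax_nonneg _))
  rw [← Finset.sum_mul] at hv2
  have h5 := mul_lt_mul_of_pos_right (hdom l) hpos
  exact absurd (hb.trans (hv.trans hv2)) (not_le.mpr h5)
end

section
/- Suppose that at every feasible point q the Jacobian matrix Df(q) of the multi-commodity dynamics, partitioned into commodity blocks (the (p,ℓ) block consisting of the partial derivatives of the commodity-p dynamics with respect to the commodity-ℓ queue variables), satisfies: (i) block strict diagonal dominance: σ_min(J_{ℓ,ℓ}) > Σ_{p≠ℓ} σ_max(J_{p,ℓ}) for every commodity ℓ; and (ii) the M-matrix condition: ∂g_{ij}^{(ℓ)}/∂q_i^{(ℓ)} > 0 and ∂g_{ij}^{(ℓ)}/∂q_j^{(ℓ)} < 0 for every edge (i,j) ∈ E and every ℓ, ∂g_{iT}^{(ℓ)}/∂q_i^{(ℓ)}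 ≥ 0 for every node i, and ∂g_{iT}^{(ℓ)}/∂q_i^{(ℓ)} > 0 for at least one node i, for every ℓ. Then the system has at most one equilibrium point, and at any equilibrium point every eigenvalue of the Jacobian has strictly negative real part. (This is the paper's Theorem 4.) -/
/-- A multi-commodity network system: a finite directed acyclic graph on
`Fin N` with edge set `E`, `C` commodities, per-commodity buffer sizes
`b i ℓ ∈ (0,∞]`, nonnegative arrival rates `lam i ℓ`, `C¹` policies
`g i j ℓ` depending on the commodity queue vectors at nodes `i` and `j`, and
`C¹` departure functions `gT i ℓ` depending on the commodity queue vector at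
node `i`.  The state is a vector `q : Fin N × Fin C → ℝ`, with `q (i, ℓ)`
the queue length of commodity `ℓ` at node `i`. -/
structure MultiCommoditySystem (N C : ℕ) where
  E : Finset (Fin N × Fin N)
  no_self_loops : ∀ e ∈ E, e.1 ≠ e.2
  antisymm : ∀ i u : Fin N, (i, u) ∈ E → (u, i) ∉ E
  acyclic : ∃ rank : Fin N → ℕ, ∀ e ∈ E, rank e.1 < rank e.2
  b : Fin N → Fin C → EReal
  b_pos : ∀ i ℓ, 0 < b i ℓ
  lam : Fin N → Fin C → ℝ
  lam_nonneg : ∀ i ℓ, 0 ≤ lam i ℓ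
  g : Fin N → Fin N → Fin C → (Fin C → ℝ) → (Fin C → ℝ) → ℝ
  gT : Fin N → Fin C → (Fin C → ℝ) → ℝ
  g_contDiff : ∀ e ∈ E, ∀ ℓ,
    ContDiff ℝ 1 (fun x : (Fin C → ℝ) × (Fin C → ℝ) => g e.1 e.2 ℓ x.1 x.2)
  gT_contDiff : ∀ i ℓ, ContDiff ℝ 1 (gT i ℓ)

namespace MultiCommoditySystem

variable {N C : ℕ} (S : MultiCommoditySystem N C)

/-- Feasibility: `0 ≤ q i ℓ ≤ b i ℓ` for every node `i` and commodity `ℓ`. -/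
def Feasible (q : Fin N × Fin C → ℝ) : Prop :=
  ∀ i ℓ, 0 ≤ q (i, ℓ) ∧ (q (i, ℓ) : EReal) ≤ S.b i ℓ

/-- The dynamics `f i ℓ (q) = lam i ℓ + Σ_{k:(k,i)∈E} g k i ℓ
− Σ_{j:(i,j)∈E} g i j ℓ − gT i ℓ`. -/
noncomputable def f (q : Fin N × Fin C → ℝ) (i : Fin N) (ℓ : Fin C) : ℝ :=
  S.lam i ℓ
    + ∑ k ∈ Finset.univ.filter fun k => (k, i) ∈ S.E,
        S.g k i ℓ (fun c => q (k, c)) (fun c => q (i, c))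
    - ∑ j ∈ Finset.univ.filter fun j => (i, j) ∈ S.E,
        S.g i j ℓ (fun c => q (i, c)) (fun c => q (j, c))
    - S.gT i ℓ (fun c => q (i, c))

/-- The Jacobian of the dynamics at `q`: entry `((i,p),(j,ℓ))` is the
partial derivative of `f i p` with respect to the queue variable `q (j, ℓ)`. -/
noncomputable def jacobian (q : Fin N × Fin C → ℝ) :
    Matrix (Fin N × Fin C) (Fin N × Fin C) ℝ :=
  fun a v => deriv (fun x => S.f (Function.update q v x) a.1 a.2) (q v)

/-- The `(p,ℓ)` commodity block of the Jacobian: the partial derivatives of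
the commodity-`p` dynamics with respect to the commodity-`ℓ` queue variables. -/
noncomputable def block (q : Fin N × Fin C → ℝ) (p ℓ : Fin C) :
    Matrix (Fin N) (Fin N) ℝ :=
  Matrix.of fun i j => S.jacobian q (i, p) (j, ℓ)

/-- Block strict diagonal dominance (in the ℓ2 sense) of the Jacobian at `q`:
`σ_min(J_{ℓ,ℓ}) > Σ_{p≠ℓ} σ_max(J_{p,ℓ})` for every commodity `ℓ`. -/
def BlockDiagDominant (q : Fin N × Fin C → ℝ) : Prop :=
  ∀ ℓ, ∑ p ∈ Finset.univ.erase ℓ, sigmaMax (S.block q p ℓ) < sigmaMin (S.block q ℓ ℓ)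

/-- The M-matrix (sign) condition at `q`: for every commodity `ℓ`,
`∂g_{ij}^{(ℓ)}/∂q_i^{(ℓ)} > 0` and `∂g_{ij}^{(ℓ)}/∂q_j^{(ℓ)} < 0` for every
edge `(i,j) ∈ E`, `∂gT_i^{(ℓ)}/∂q_i^{(ℓ)} ≥ 0` for every node `i`, and
`∂gT_i^{(ℓ)}/∂q_i^{(ℓ)} > 0` for at least one node `i`. -/
def MMatrixCond (q : Fin N × Fin C → ℝ) : Prop :=
  ∀ ℓ : Fin C,
    (∀ e ∈ S.E,
      0 < deriv (fun x => S.g e.1 e.2 ℓ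
            (Function.update (fun c => q (e.1, c)) ℓ x) (fun c => q (e.2, c)))
          (q (e.1, ℓ)) ∧
      deriv (fun y => S.g e.1 e.2 ℓ
            (fun c => q (e.1, c)) (Function.update (fun c => q (e.2, c)) ℓ y))
          (q (e.2, ℓ)) < 0) ∧
    (∀ i, 0 ≤ deriv (fun x => S.gT i ℓ (Function.update (fun c => q (i, c)) ℓ x))
          (q (i, ℓ))) ∧
    (∃ i, 0 < deriv (fun x => S.gT i ℓ (Function.update (fun c => q (i, c)) ℓ x))
          (q (i, ℓ)))

end MultiCommoditySystem

open Matrix in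
theorem aux_psd_s5 {n : Type*} [Fintype n] [DecidableEq n] (H : Matrix n n ℝ) (hH : H.IsHermitian)
    (h : ∀ r ∈ spectrum ℝ H, 0 ≤ r) (x : n → ℝ) : 0 ≤ x ⬝ᵥ (H *ᵥ x) := by
  have h1 : H.PosSemidef := hH.posSemidef_iff_eigenvalues_nonneg.2
    (fun i => h _ (hH.eigenvalues_mem_spectrum_real i))
  have := h1.dotProduct_mulVec_nonneg x
  simpa using this

open Matrix in
theorem aux_lower {n : Type*} [Fintype n] [DecidableEq n] (H : Matrix n n ℝ) (hH : H.IsHermitian)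
    (x : n → ℝ) : sInf {r : ℝ | H.charpoly.IsRoot r} * (x ⬝ᵥ x) ≤ x ⬝ᵥ (H *ᵥ x) := by
  set c := sInf {r : ℝ | H.charpoly.IsRoot r} with hc
  have hset : {r : ℝ | H.charpoly.IsRoot r} = spectrum ℝ H := by
    ext r; exact mem_spectrum_iff_isRoot_charpoly.symm
  have h := aux_psd_s5 (H - algebraMap ℝ _ c)
    (hH.sub (by rw [Algebra.algebraMap_eq_smul_one]; simp [IsHermitian])) (by
      intro r hr
      have : c + r ∈ spectrum ℝ H := by
        have := spectrum.add_mem_iff (R := ℝ) (a := H - algebraMap ℝ _ c) (r := r) (s := -c)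
        have h2 := spectrum.add_mem_add_iff (R := ℝ) (a := H - algebraMap ℝ _ c) (r := r) (s := c)
        have h3 := h2.2 hr
        simpa [add_comm] using h3
      rw [hset] at hc
      have h4 : c ≤ c + r := by
        conv_lhs => rw [hc]
        exact csInf_le H.finite_real_spectrum.bddBelow this
      linarith) x
  rw [sub_mulVec, dotProduct_sub, Algebra.algebraMap_eq_smul_one, smul_mulVec, one_mulVec,
    dotProduct_smul, smul_eq_mul] at h
  linarith

open Matrix in
theorem aux_upper {n : Type*} [Fintype n] [DecidableEq n] (H : Matrix n n ℝ) (hH : H.IsHermitian)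
    (x : n → ℝ) : x ⬝ᵥ (H *ᵥ x) ≤ sSup {r : ℝ | H.charpoly.IsRoot r} * (x ⬝ᵥ x) := by
  have hset : {r : ℝ | H.charpoly.IsRoot r} = spectrum ℝ H := by
    ext r; exact mem_spectrum_iff_isRoot_charpoly.symm
  have h := aux_lower (-H) hH.neg x
  have hset' : {r : ℝ | (-H).charpoly.IsRoot r} = - spectrum ℝ H := by
    rw [spectrum.neg_eq]
    ext r; exact mem_spectrum_iff_isRoot_charpoly.symm
  rw [hset', Real.sInf_neg, neg_mulVec, dotProduct_neg] at h
  rw [hset]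
  linarith

open Matrix in
theorem aux_sigmaMax {n : Type*} [Fintype n] [DecidableEq n] (M : Matrix n n ℝ) (x : n → ℝ) :
    ∑ i, (M *ᵥ x) i ^ 2 ≤ sigmaMax M ^ 2 * ∑ i, x i ^ 2 := by
  have h := aux_upper (Mᵀ * M) (isHermitian_conjTranspose_mul_self M) x
  have e1 : x ⬝ᵥ ((Mᵀ * M) *ᵥ x) = ∑ i, (M *ᵥ x) i ^ 2 := by
    rw [← mulVec_mulVec, dotProduct_mulVec, vecMul_transpose, dotProduct]
    simp [sq]
  have e2 : x ⬝ᵥ x = ∑ i, x i ^ 2 := by simp [dotProduct, sq]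
  rw [e1, e2] at h
  refine h.trans (mul_le_mul_of_nonneg_right ?_ (Finset.sum_nonneg fun i _ => sq_nonneg _))
  unfold sigmaMax
  rcases le_total 0 (sSup {r : ℝ | (Mᵀ * M).charpoly.IsRoot r}) with h0 | h0
  · rw [Real.sq_sqrt h0]
  · exact h0.trans (sq_nonneg _)

open Matrix in
theorem aux_sigmaMin_t {n : Type*} [Fintype n] [DecidableEq n] (M : Matrix n n ℝ) (x : n → ℝ) :
    sigmaMin M ^ 2 * ∑ i, x i ^ 2 ≤ ∑ i, (Mᵀ *ᵥ x) i ^ 2 := by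
  have h := aux_lower (M * Mᵀ) (isHermitian_mul_conjTranspose_self M) x
  have e1 : x ⬝ᵥ ((M * Mᵀ) *ᵥ x) = ∑ i, (Mᵀ *ᵥ x) i ^ 2 := by
    rw [← mulVec_mulVec, dotProduct_mulVec, ← mulVec_transpose, dotProduct]
    simp [sq]
  have e2 : x ⬝ᵥ x = ∑ i, x i ^ 2 := by simp [dotProduct, sq]
  rw [e1, e2] at h
  unfold sigmaMin
  rcases le_total 0 (sInf {r : ℝ | (M * Mᵀ).charpoly.IsRoot r}) with h0 | h0
  · rw [Real.sq_sqrt h0]; exact h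
  · rw [Real.sqrt_eq_zero_of_nonpos h0]
    simpa using Finset.sum_nonneg fun i _ => sq_nonneg ((Mᵀ *ᵥ x) i)

theorem aux_sigmaMin_transpose {n : Type*} [Fintype n] [DecidableEq n] (M : Matrix n n ℝ) :
    sigmaMin M.transpose = sigmaMin M := by
  unfold sigmaMin
  rw [Matrix.transpose_transpose, Matrix.charpoly_mul_comm]

theorem aux_sigmaMax_transpose {n : Type*} [Fintype n] [DecidableEq n] (M : Matrix n n ℝ) :
    sigmaMax M.transpose = sigmaMax M := by
  unfold sigmaMax
  rw [Matrix.transpose_transpose, Matrix.charpoly_mul_comm]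

theorem aux_sigmaMin_neg {n : Type*} [Fintype n] [DecidableEq n] (M : Matrix n n ℝ) :
    sigmaMin (-M) = sigmaMin M := by
  unfold sigmaMin
  rw [Matrix.transpose_neg, neg_mul_neg]

theorem aux_sigmaMax_neg {n : Type*} [Fintype n] [DecidableEq n] (M : Matrix n n ℝ) :
    sigmaMax (-M) = sigmaMax M := by
  unfold sigmaMax
  rw [Matrix.transpose_neg, neg_mul_neg]

open Matrix in
/-- `A` is injective with nonnegative inverse, bound `s`. -/
structure AuxGood {n : Type*} [Fintype n] (A : Matrix n n ℝ) (s : ℝ) : Prop where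
  pos : 0 < s
  bound : ∀ x : n → ℝ, s ^ 2 * ∑ i, x i ^ 2 ≤ ∑ i, (A *ᵥ x) i ^ 2
  mono : ∀ x : n → ℝ, (∀ i, 0 ≤ (A *ᵥ x) i) → ∀ i, 0 ≤ x i
  surj : ∀ y : n → ℝ, ∃ x, A *ᵥ x = y
  off : ∀ i j, i ≠ j → A i j ≤ 0
  diag : ∀ i, 0 ≤ A i i

open Matrix in
theorem aux_inj {n : Type*} [Fintype n] (A : Matrix n n ℝ) (s : ℝ) (hs : 0 < s)
    (hb : ∀ x : n → ℝ, s ^ 2 * ∑ i, x i ^ 2 ≤ ∑ i, (A *ᵥ x) i ^ 2) (x : n → ℝ)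
    (hx : A *ᵥ x = 0) : x = 0 := by
  have h := hb x
  rw [hx] at h
  simp only [Pi.zero_apply, ne_eq, OfNat.ofNat_ne_zero, not_false_eq_true, zero_pow,
    Finset.sum_const_zero] at h
  have h2 : ∑ i, x i ^ 2 ≤ 0 := by
    by_contra hc
    push Not at hc
    have := mul_pos (pow_pos hs 2) hc
    linarith
  have h3 := (Finset.sum_eq_zero_iff_of_nonneg (fun i _ => sq_nonneg (x i))).1
    (le_antisymm h2 (Finset.sum_nonneg fun i _ => sq_nonneg _))
  ext i
  simpa using h3 i (Finset.mem_univ i)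

open Matrix in
theorem aux_surj {n : Type*} [Fintype n] [DecidableEq n] (A : Matrix n n ℝ) (s : ℝ) (hs : 0 < s)
    (hb : ∀ x : n → ℝ, s ^ 2 * ∑ i, x i ^ 2 ≤ ∑ i, (A *ᵥ x) i ^ 2) (y : n → ℝ) :
    ∃ x, A *ᵥ x = y := by
  have hinj : Function.Injective A.mulVecLin := by
    rw [← LinearMap.ker_eq_bot, LinearMap.ker_eq_bot']
    intro x hx
    exact aux_inj A s hs hb x hx
  exact (LinearMap.injective_iff_surjective.1 hinj) y

open Matrix in
theorem aux_good {n : Type*} [Fintype n] [DecidableEq n] (A : Matrix n n ℝ)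
    (hs : 0 < sigmaMin A) (off : ∀ i j, i ≠ j → A i j ≤ 0) (col : ∀ j, 0 ≤ ∑ i, A i j) :
    AuxGood A (sigmaMin A) ∧ AuxGood Aᵀ (sigmaMin A) := by
  have bt := aux_sigmaMin_t A
  have b : ∀ x : n → ℝ, sigmaMin A ^ 2 * ∑ i, x i ^ 2 ≤ ∑ i, (A *ᵥ x) i ^ 2 := by
    intro x
    have := aux_sigmaMin_t Aᵀ x
    rwa [aux_sigmaMin_transpose, transpose_transpose] at this
  have diag : ∀ i, 0 ≤ A i i := by
    intro i
    have h := col i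
    rw [← Finset.add_sum_erase _ _ (Finset.mem_univ i)] at h
    have : ∑ j ∈ Finset.univ.erase i, A j i ≤ 0 :=
      Finset.sum_nonpos fun j hj => off j i (Finset.ne_of_mem_erase hj)
    linarith
  have mono : ∀ x : n → ℝ, (∀ i, 0 ≤ (A *ᵥ x) i) → ∀ i, 0 ≤ x i := by
    intro x hx
    set v : n → ℝ := fun i => max (-(x i)) 0 with hv
    set w : n → ℝ := fun i => max (x i) 0 with hw
    have hxv : x = w - v := by
      ext i
      simp only [hv, hw, Pi.sub_apply]
      rcases le_total 0 (x i) with h | h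
      · rw [max_eq_left h, max_eq_right (by linarith)]; ring
      · rw [max_eq_right h, max_eq_left (by linarith)]; ring
    have hz : ∀ (u : n → ℝ) (i : n), (∀ j, 0 ≤ u j) → u i = 0 → (A *ᵥ u) i ≤ 0 := by
      intro u i hu hi
      simp only [mulVec, dotProduct]
      refine Finset.sum_nonpos fun j _ => ?_
      by_cases hij : i = j
      · subst hij; simp [hi]
      · exact mul_nonpos_of_nonpos_of_nonneg (off i j hij) (hu j)
    have hv0 : ∀ j, 0 ≤ v j := fun j => le_max_right _ _
    have hw0 : ∀ j, 0 ≤ w j := fun j => le_max_right _ _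
    have hle : ∀ i, (A *ᵥ v) i ≤ 0 := by
      intro i
      rcases le_total 0 (x i) with h | h
      · exact hz v i hv0 (max_eq_right (by linarith))
      · have h1 := hz w i hw0 (max_eq_right h)
        have h2 := hx i
        rw [hxv, mulVec_sub, Pi.sub_apply] at h2
        linarith
    have hsum : 0 ≤ ∑ i, (A *ᵥ v) i := by
      simp only [mulVec, dotProduct]
      rw [Finset.sum_comm]
      refine Finset.sum_nonneg fun j _ => ?_
      rw [← Finset.sum_mul]
      exact mul_nonneg (col j) (hv0 j)
    have hzero : A *ᵥ v = 0 := by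
      have := (Finset.sum_eq_zero_iff_of_nonpos (fun i _ => hle i)).1
        (le_antisymm (Finset.sum_nonpos fun i _ => hle i) hsum)
      ext i
      exact this i (Finset.mem_univ i)
    have hv00 := aux_inj A _ hs b v hzero
    intro i
    have := congrFun hv00 i
    simp only [hv, Pi.zero_apply] at this
    have h3 := le_max_left (-(x i)) 0
    linarith
  have surj := aux_surj A _ hs b
  refine ⟨⟨hs, b, mono, surj, off, diag⟩, ⟨hs, bt, ?_, aux_surj _ _ hs bt,
    fun i j hij => off j i (Ne.symm hij), diag⟩⟩
  intro x hx i
  obtain ⟨y, hy⟩ := surj (Pi.single i 1)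
  have hy0 : ∀ j, 0 ≤ y j := mono y (by
    intro j; rw [hy]
    by_cases hij : j = i
    · subst hij; simp
    · simp [hij])
  have : x i = (Aᵀ *ᵥ x) ⬝ᵥ y := by
    rw [mulVec_transpose, ← dotProduct_mulVec, hy]; simp
  rw [this]
  exact Finset.sum_nonneg fun j _ => mul_nonneg (hx j) (hy0 j)

open Matrix in
theorem aux_compare {n : Type*} [Fintype n] {A : Matrix n n ℝ} {s : ℝ} (hA : AuxGood A s)
    (x r : n → ℂ) (h : ∀ i, (A *ᵥ (fun j => ‖x j‖)) i ≤ ‖r i‖) :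
    s * ‖WithLp.toLp 2 x‖ ≤ ‖WithLp.toLp 2 r‖ := by
  obtain ⟨y, hy⟩ := hA.surj (fun j => ‖r j‖)
  have hxy : ∀ i, ‖x i‖ ≤ y i := by
    intro i
    have := hA.mono (y - fun j => ‖x j‖) (by
      intro i
      rw [mulVec_sub, hy, Pi.sub_apply]
      linarith [h i]) i
    simpa using this
  have h1 := hA.bound y
  rw [hy] at h1
  have h2 : ∑ i, ‖x i‖ ^ 2 ≤ ∑ i, y i ^ 2 :=
    Finset.sum_le_sum fun i _ => pow_le_pow_left₀ (norm_nonneg _) (hxy i) 2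
  have h3 : (s * ‖WithLp.toLp 2 x‖) ^ 2 ≤ ‖WithLp.toLp 2 r‖ ^ 2 := by
    rw [mul_pow, EuclideanSpace.norm_sq_eq, EuclideanSpace.norm_sq_eq]
    exact (mul_le_mul_of_nonneg_left h2 (sq_nonneg s)).trans h1
  exact le_of_sq_le_sq h3 (norm_nonneg _)

open Matrix in
theorem aux_sigmaMax_complex {n : Type*} [Fintype n] [DecidableEq n] (M : Matrix n n ℝ)
    (x : n → ℂ) :
    ‖WithLp.toLp 2 (M.map (fun a : ℝ => (a : ℂ)) *ᵥ x)‖ ≤ sigmaMax M * ‖WithLp.toLp 2 x‖ := by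
  have h0 : 0 ≤ sigmaMax M := Real.sqrt_nonneg _
  refine le_of_sq_le_sq ?_ (by positivity)
  rw [mul_pow, EuclideanSpace.norm_sq_eq, EuclideanSpace.norm_sq_eq]
  have h1 := aux_sigmaMax M (fun i => (x i).re)
  have h2 := aux_sigmaMax M (fun i => (x i).im)
  have e1 : ∀ z : ℂ, ‖z‖ ^ 2 = z.re ^ 2 + z.im ^ 2 := by
    intro z; rw [Complex.sq_norm, Complex.normSq_apply]; ring
  simp only [e1, Finset.sum_add_distrib, mul_add]
  have e2 : ∀ i, ((M.map (fun a : ℝ => (a : ℂ)) *ᵥ x) i).re = (M *ᵥ (fun i => (x i).re)) i := by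
    intro i; simp [mulVec, dotProduct]
  have e3 : ∀ i, ((M.map (fun a : ℝ => (a : ℂ)) *ᵥ x) i).im = (M *ᵥ (fun i => (x i).im)) i := by
    intro i; simp [mulVec, dotProduct]
  simp only [e2, e3]
  exact add_le_add h1 h2

open Matrix in
theorem aux_row {n : Type*} [Fintype n] {A : Matrix n n ℝ} {s : ℝ} (hA : AuxGood A s)
    (x : n → ℂ) (r : ℂ) (i : n)
    (h : x i = 0 ∨ ∃ w : ℂ, w.re ≤ 0 ∧ (A.map (fun a : ℝ => (a : ℂ)) *ᵥ x) i + r = w * x i) :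
    (A *ᵥ (fun j => ‖x j‖)) i ≤ ‖r‖ := by
  classical
  have e : (A *ᵥ (fun j => ‖x j‖)) i
      = A i i * ‖x i‖ + ∑ j ∈ Finset.univ.erase i, A i j * ‖x j‖ := by
    simp only [mulVec, dotProduct]
    rw [Finset.add_sum_erase _ (fun j => A i j * ‖x j‖) (Finset.mem_univ i)]
  have e' : (A.map (fun a : ℝ => (a : ℂ)) *ᵥ x) i
      = (A i i : ℂ) * x i + ∑ j ∈ Finset.univ.erase i, (A i j : ℂ) * x j := by
    simp only [mulVec, dotProduct, map_apply]
    rw [Finset.add_sum_erase _ (fun j => (A i j : ℂ) * x j) (Finset.mem_univ i)]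
  have hneg : ∀ j ∈ Finset.univ.erase i, A i j * ‖x j‖ = - ‖(A i j : ℂ) * x j‖ := by
    intro j hj
    rw [norm_mul, Complex.norm_real, Real.norm_eq_abs,
      abs_of_nonpos (hA.off i j (Finset.ne_of_mem_erase hj).symm)]
    ring
  rw [e, Finset.sum_congr rfl hneg, Finset.sum_neg_distrib]
  have hS : ‖∑ j ∈ Finset.univ.erase i, (A i j : ℂ) * x j‖
      ≤ ∑ j ∈ Finset.univ.erase i, ‖(A i j : ℂ) * x j‖ := norm_sum_le _ _
  rcases h with h | ⟨w, hw, h⟩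
  · rw [h, norm_zero, mul_zero]
    have := norm_nonneg r
    have := norm_nonneg (∑ j ∈ Finset.univ.erase i, (A i j : ℂ) * x j)
    linarith
  · rw [e'] at h
    have h1 : ((A i i : ℂ) - w) * x i
        = -(r + ∑ j ∈ Finset.univ.erase i, (A i j : ℂ) * x j) := by
      linear_combination h
    have h2 : A i i * ‖x i‖ ≤ ‖((A i i : ℂ) - w) * x i‖ := by
      rw [norm_mul]
      refine mul_le_mul_of_nonneg_right ?_ (norm_nonneg _)
      have := Complex.re_le_norm ((A i i : ℂ) - w)
      simp only [Complex.sub_re, Complex.ofReal_re] at this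
      linarith
    rw [h1, norm_neg] at h2
    have h3 := norm_add_le r (∑ j ∈ Finset.univ.erase i, (A i j : ℂ) * x j)
    linarith

/-- The `(p,l)` block. -/
def auxBlock {n k : Type*} (B : Matrix (n × k) (n × k) ℝ) (p l : k) : Matrix n n ℝ :=
  Matrix.of fun i j => B (i, p) (j, l)

open Matrix in
theorem aux_block_ineq {n k : Type*} [Fintype n] [Fintype k] [DecidableEq n] [DecidableEq k]
    (B : Matrix (n × k) (n × k) ℝ) (s : k → ℝ) (hB : ∀ p, AuxGood (auxBlock B p p) (s p))
    (x : n × k → ℂ)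
    (h : ∀ a, x a = 0 ∨ ∃ w : ℂ, w.re ≤ 0 ∧ (B.map (fun a : ℝ => (a : ℂ)) *ᵥ x) a = w * x a)
    (p : k) :
    s p * ‖WithLp.toLp 2 (fun i => x (i, p))‖
      ≤ ∑ l ∈ Finset.univ.erase p,
        sigmaMax (auxBlock B p l) * ‖WithLp.toLp 2 (fun i => x (i, l))‖ := by
  set r : n → ℂ := ∑ l ∈ Finset.univ.erase p,
    (auxBlock B p l).map (fun a : ℝ => (a : ℂ)) *ᵥ (fun i => x (i, l)) with hr
  have key : ∀ i, (B.map (fun a : ℝ => (a : ℂ)) *ᵥ x) (i, p)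
      = ((auxBlock B p p).map (fun a : ℝ => (a : ℂ)) *ᵥ (fun i => x (i, p))) i + r i := by
    intro i
    rw [hr, Finset.sum_apply, Finset.add_sum_erase _
      (fun l => ((auxBlock B p l).map (fun a : ℝ => (a : ℂ)) *ᵥ (fun i => x (i, l))) i)
      (Finset.mem_univ p)]
    simp only [mulVec, dotProduct, map_apply, auxBlock, of_apply]
    rw [Fintype.sum_prod_type, Finset.sum_comm]
  refine (aux_compare (hB p) (fun i => x (i, p)) r fun i => aux_row (hB p) _ _ i ?_).trans ?_
  · rcases h (i, p) with h | ⟨w, hw, h⟩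
    · exact Or.inl h
    · exact Or.inr ⟨w, hw, by rw [← key, h]⟩
  · rw [hr, WithLp.toLp_sum]
    exact (norm_sum_le _ _).trans (Finset.sum_le_sum fun l _ => aux_sigmaMax_complex _ _)

theorem aux_zero_of_norm {n k : Type*} [Fintype n] (x : n × k → ℂ)
    (h : ∀ p, ‖WithLp.toLp 2 (fun i => x (i, p))‖ ≤ 0) : x = 0 := by
  ext ⟨i, p⟩
  have h1 := norm_le_zero_iff.1 (h p)
  have := congrArg (fun v : EuclideanSpace ℂ n => WithLp.ofLp v i) h1
  simpa using this

open Matrix in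
theorem aux_block_col {n k : Type*} [Fintype n] [Fintype k] [DecidableEq n] [DecidableEq k]
    (B : Matrix (n × k) (n × k) ℝ) (s : k → ℝ) (hB : ∀ p, AuxGood (auxBlock B p p) (s p))
    (hd : ∀ l, ∑ p ∈ Finset.univ.erase l, sigmaMax (auxBlock B p l) < s l)
    (x : n × k → ℂ)
    (h : ∀ a, x a = 0 ∨ ∃ w : ℂ, w.re ≤ 0 ∧ (B.map (fun a : ℝ => (a : ℂ)) *ᵥ x) a = w * x a) :
    x = 0 := by
  have hi := aux_block_ineq B s hB x h
  set m : k → ℝ := fun p => ‖WithLp.toLp 2 (fun i => x (i, p))‖ with hm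
  have hm0 : ∀ p, 0 ≤ m p := fun p => norm_nonneg _
  have h1 : ∑ p, s p * m p ≤ ∑ p, ∑ l ∈ Finset.univ.erase p, sigmaMax (auxBlock B p l) * m l :=
    Finset.sum_le_sum fun p _ => hi p
  have h2 : ∑ p, ∑ l ∈ Finset.univ.erase p, sigmaMax (auxBlock B p l) * m l
      = ∑ l, (∑ p ∈ Finset.univ.erase l, sigmaMax (auxBlock B p l)) * m l := by
    simp only [Finset.sum_mul]
    refine Finset.sum_comm' ?_
    intro a b
    simp [eq_comm]
  rw [h2] at h1
  have h3 : ∑ l, (s l - ∑ p ∈ Finset.univ.erase l, sigmaMax (auxBlock B p l)) * m l ≤ 0 := by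
    simp only [sub_mul, Finset.sum_sub_distrib]
    linarith
  have hnn : ∀ l ∈ Finset.univ,
      0 ≤ (s l - ∑ p ∈ Finset.univ.erase l, sigmaMax (auxBlock B p l)) * m l :=
    fun l _ => mul_nonneg (by linarith [hd l]) (hm0 l)
  have h4 := (Finset.sum_eq_zero_iff_of_nonneg hnn).1 (le_antisymm h3 (Finset.sum_nonneg hnn))
  refine aux_zero_of_norm x fun p => ?_
  rcases mul_eq_zero.1 (h4 p (Finset.mem_univ p)) with h5 | h5
  · linarith [hd p]
  · exact h5.le

open Matrix in
theorem aux_block_row {n k : Type*} [Fintype n] [Fintype k] [DecidableEq n] [DecidableEq k]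
    (B : Matrix (n × k) (n × k) ℝ) (s : k → ℝ) (hB : ∀ p, AuxGood (auxBlock B p p) (s p))
    (hd : ∀ p, ∑ l ∈ Finset.univ.erase p, sigmaMax (auxBlock B p l) < s p)
    (x : n × k → ℂ)
    (h : ∀ a, x a = 0 ∨ ∃ w : ℂ, w.re ≤ 0 ∧ (B.map (fun a : ℝ => (a : ℂ)) *ᵥ x) a = w * x a) :
    x = 0 := by
  have hi := aux_block_ineq B s hB x h
  set m : k → ℝ := fun p => ‖WithLp.toLp 2 (fun i => x (i, p))‖ with hm
  have hm0 : ∀ p, 0 ≤ m p := fun p => norm_nonneg _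
  refine aux_zero_of_norm x fun q => ?_
  obtain ⟨p, -, hp⟩ := Finset.exists_max_image Finset.univ m ⟨q, Finset.mem_univ q⟩
  have h1 : ∑ l ∈ Finset.univ.erase p, sigmaMax (auxBlock B p l) * m l
      ≤ (∑ l ∈ Finset.univ.erase p, sigmaMax (auxBlock B p l)) * m p := by
    rw [Finset.sum_mul]
    exact Finset.sum_le_sum fun l _ => mul_le_mul_of_nonneg_left (hp l (Finset.mem_univ l))
      (Real.sqrt_nonneg _)
  have h2 := (hi p).trans h1
  have h3 : m p ≤ 0 := by
    by_contra hc
    push Not at hc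
    have := mul_lt_mul_of_pos_right (hd p) hc
    change s p * m p ≤ _ at h2
    linarith
  exact (hp q (Finset.mem_univ q)).trans h3

open Matrix in
theorem aux_real {n : Type*} [Fintype n] (B : Matrix n n ℝ)
    (hB : ∀ x : n → ℂ, (∀ a, x a = 0 ∨ ∃ w : ℂ, w.re ≤ 0 ∧
      (B.map (fun a : ℝ => (a : ℂ)) *ᵥ x) a = w * x a) → x = 0)
    (u : n → ℝ) (hu : ∀ i, u i * (B *ᵥ u) i ≤ 0) : u = 0 := by
  have := hB (fun i => (u i : ℂ)) (by
    intro a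
    by_cases ha : u a = 0
    · left; simp [ha]
    · right
      refine ⟨(((B *ᵥ u) a / u a : ℝ) : ℂ), ?_, ?_⟩
      · rw [Complex.ofReal_re]
        have h1 : (B *ᵥ u) a / u a = (u a * (B *ᵥ u) a) / (u a) ^ 2 := by field_simp
        rw [h1]
        exact div_nonpos_of_nonpos_of_nonneg (hu a) (sq_nonneg _)
      · rw [← Complex.ofReal_mul, div_mul_cancel₀ _ ha]
        simp [mulVec, dotProduct])
  ext i
  simpa using congrFun this i

open Matrix in
theorem aux_direction {n : Type*} [Fintype n] (A : Matrix n n ℝ)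
    (hA : ∀ u : n → ℝ, (∀ i, u i * (Aᵀ *ᵥ u) i ≤ 0) → u = 0) (d : n → ℝ) :
    ∃ k : n → ℝ, (∀ i, 0 < k i) ∧ ∀ i, d i ≠ 0 → 0 < d i * (A *ᵥ (fun j => k j * d j)) i := by
  classical
  let T := {i : n // d i ≠ 0}
  let v : n ⊕ T → (n → ℝ) := Sum.elim (fun i => Pi.single i 1) (fun i j => d i * A i j * d j)
  let L : (n ⊕ T → ℝ) →ₗ[ℝ] (n → ℝ) := Fintype.linearCombination ℝ v
  let D : Set (n → ℝ) := L '' stdSimplex ℝ (n ⊕ T)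
  have hconv : Convex ℝ D := (convex_stdSimplex ℝ _).linear_image L
  have hcomp : IsCompact D := (isCompact_stdSimplex ℝ _).image L.continuous_of_finiteDimensional
  have h0 : (0 : n → ℝ) ∉ D := by
    rintro ⟨y, ⟨hy0, hy1⟩, hy⟩
    have hyj : ∀ j, y (Sum.inl j) + ∑ i : T, y (Sum.inr i) * (d i * A i j * d j) = 0 := by
      intro j
      have := congrFun hy j
      simp only [L, v, Fintype.linearCombination_apply, Fintype.sum_sum_type, Sum.elim_inl,
        Sum.elim_inr, Finset.sum_apply, Pi.smul_apply, smul_eq_mul,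
        Pi.zero_apply, Pi.single_apply] at this
      simpa using this
    let yy : n → ℝ := fun i => if h : d i ≠ 0 then y (Sum.inr ⟨i, h⟩) else 0
    have hyy : ∀ i : T, yy i = y (Sum.inr i) := fun i => dif_pos i.2
    have hyy0 : ∀ i, 0 ≤ yy i := by
      intro i
      by_cases h : d i ≠ 0
      · simp only [yy, dif_pos h]; exact hy0 _
      · simp only [yy, dif_neg h]; exact le_rfl
    have hsum : ∀ j, ∑ i : T, y (Sum.inr i) * (d i * A i j * d j)
        = d j * (Aᵀ *ᵥ (fun i => yy i * d i)) j := by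
      intro j
      simp only [mulVec, dotProduct, transpose_apply, Finset.mul_sum]
      rw [← Finset.sum_filter_of_ne (s := Finset.univ) (p := fun i => d i ≠ 0)
        (f := fun i => d j * (A i j * (yy i * d i)))
        (fun i _ hne h0 => hne (by simp [h0])),
        Finset.sum_subtype (p := fun i => d i ≠ 0) _ (by simp)]
      refine Finset.sum_congr rfl fun i _ => ?_
      rw [hyy i]; ring
    have hw := hA (fun i => yy i * d i) (by
      intro j
      have h1 := hyj j
      rw [hsum] at h1
      have : yy j * d j * (Aᵀ *ᵥ (fun i => yy i * d i)) j = - (yy j * y (Sum.inl j)) := by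
        linear_combination yy j * h1
      rw [this]
      have := mul_nonneg (hyy0 j) (hy0 (Sum.inl j))
      linarith)
    have hr : ∀ i : T, y (Sum.inr i) = 0 := by
      intro i
      have := congrFun hw i
      simp only [Pi.zero_apply, mul_eq_zero, i.2, or_false] at this
      rw [← hyy]; exact this
    have hl : ∀ j, y (Sum.inl j) = 0 := by
      intro j
      have := hyj j
      simpa [hr] using this
    rw [Fintype.sum_sum_type] at hy1
    simp [hr, hl] at hy1
  obtain ⟨f, c, hc, hf⟩ := geometric_hahn_banach_point_closed hconv hcomp.isClosed h0
  rw [map_zero] at hc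
  have hv : ∀ a, 0 < f (v a) := by
    intro a
    refine hc.trans (hf _ ⟨Pi.single a 1, single_mem_stdSimplex ℝ a, ?_⟩)
    simp [L, Fintype.linearCombination_apply_single]
  refine ⟨fun i => f (Pi.single i 1), fun i => hv (Sum.inl i), fun i hi => ?_⟩
  have h1 := hv (Sum.inr ⟨i, hi⟩)
  have h2 := LinearMap.pi_apply_eq_sum_univ (f : (n → ℝ) →ₗ[ℝ] ℝ) (v (Sum.inr ⟨i, hi⟩))
  have h3 : ∀ j : n, (fun j' => if j = j' then (1 : ℝ) else 0) = Pi.single j 1 := by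
    intro j; ext j'; simp [Pi.single_apply, eq_comm]
  simp only [ContinuousLinearMap.coe_coe] at h2
  rw [h2] at h1
  convert h1 using 1
  simp only [mulVec, dotProduct, Finset.mul_sum]
  refine Finset.sum_congr rfl fun j _ => ?_
  simp only [v, Sum.elim_inr, smul_eq_mul, h3]
  ring

open Matrix Filter Topology in
theorem aux_gale_nikaido {n : Type*} [Fintype n] [DecidableEq n] (F : (n → ℝ) → (n → ℝ))
    (F' : (n → ℝ) → Matrix n n ℝ) (a b : n → ℝ)
    (hF : ∀ x, HasFDerivAt F (LinearMap.toContinuousLinearMap (F' x).mulVecLin) x)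
    (h1 : ∀ x, (∀ i, x i ∈ Set.uIcc (a i) (b i)) →
      ∀ u : n → ℝ, (∀ i, u i * (F' x *ᵥ u) i ≤ 0) → u = 0)
    (h2 : ∀ x, (∀ i, x i ∈ Set.uIcc (a i) (b i)) →
      ∀ u : n → ℝ, (∀ i, u i * ((F' x)ᵀ *ᵥ u) i ≤ 0) → u = 0)
    (hab : F a = F b) : a = b := by
  by_contra hne
  have hFc : Continuous F := continuous_iff_continuousAt.2 fun x => (hF x).continuousAt
  let X : Set (n → ℝ) := {x | (∀ i, x i ∈ Set.uIcc (a i) (b i)) ∧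
    ∀ i, (x i - a i) * (F x i - F a i) ≤ 0}
  have hXc : IsClosed X := by
    refine IsClosed.inter ?_ ?_
    · have : {x : n → ℝ | ∀ i, x i ∈ Set.uIcc (a i) (b i)}
          = ⋂ i, {x : n → ℝ | x i ∈ Set.uIcc (a i) (b i)} := by ext; simp
      change IsClosed {x : n → ℝ | ∀ i, x i ∈ Set.uIcc (a i) (b i)}
      rw [this]
      exact isClosed_iInter fun i => isClosed_Icc.preimage (continuous_apply i)
    · have : {x : n → ℝ | ∀ i, (x i - a i) * (F x i - F a i) ≤ 0}
          = ⋂ i, {x : n → ℝ | (x i - a i) * (F x i - F a i) ≤ 0} := by ext; simp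
      change IsClosed {x : n → ℝ | ∀ i, (x i - a i) * (F x i - F a i) ≤ 0}
      rw [this]
      refine isClosed_iInter fun i => isClosed_le ?_ continuous_const
      fun_prop
  have hXk : IsCompact X := by
    refine (isCompact_univ_pi (fun i => isCompact_uIcc (a := a i) (b := b i))).of_isClosed_subset
      hXc ?_
    intro x hx i _
    exact hx.1 i
  have haX : ∀ i, a i ∈ Set.uIcc (a i) (b i) := fun i => Set.left_mem_uIcc
  have hiso : a ∉ closure (X \ {a}) := by
    intro hcl
    obtain ⟨x, hx, hlim⟩ := mem_closure_iff_seq_limit.1 hcl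
    have hpos : ∀ m, 0 < ‖x m - a‖ := fun m => norm_pos_iff.2 (sub_ne_zero.2 (hx m).2)
    have hs : ∀ m, ‖x m - a‖⁻¹ • (x m - a) ∈ Metric.sphere (0 : n → ℝ) 1 := by
      intro m
      rw [mem_sphere_zero_iff_norm, norm_smul, norm_inv, norm_norm, inv_mul_cancel₀ (hpos m).ne']
    obtain ⟨u, hu, φ, hφ, hlu⟩ := (isCompact_sphere (0 : n → ℝ) 1).tendsto_subseq hs
    have hd0 : Tendsto (fun m => x (φ m) - a) atTop (𝓝 0) := by
      have := (hlim.comp hφ.tendsto_atTop).sub_const a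
      simpa using this
    have hl := (hasFDerivWithinAt_univ.2 (hF a)).lim (c := fun m => ‖x (φ m) - a‖⁻¹) hd0
      (Eventually.of_forall fun _ => Set.mem_univ _) hlu
    have hu0 := h1 a haX u (by
      intro i
      have e1 : Tendsto (fun m => (‖x (φ m) - a‖⁻¹ • (x (φ m) - a)) i) atTop (𝓝 (u i)) :=
        (continuous_apply i).continuousAt.tendsto.comp hlu
      have e2 := (continuous_apply i).continuousAt.tendsto.comp hl
      have e3 := e1.mul e2
      refine le_of_tendsto e3 (Eventually.of_forall fun m => ?_)
      have h3 := (hx (φ m)).1.2 i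
      simp only [Function.comp_apply, Pi.smul_apply, Pi.sub_apply, smul_eq_mul,
        add_sub_cancel]
      have h4 : 0 ≤ ‖x (φ m) - a‖⁻¹ ^ 2 := sq_nonneg _
      have h5 := mul_nonpos_of_nonneg_of_nonpos h4 h3
      calc _ = ‖x (φ m) - a‖⁻¹ ^ 2 * ((x (φ m) i - a i) * (F (x (φ m)) i - F a i)) := by ring
        _ ≤ 0 := h5)
    rw [hu0] at hu
    simp at hu
  have hYc : IsClosed (X \ {a}) := by
    refine isClosed_of_closure_subset fun x hx => ⟨?_, ?_⟩
    · exact hXc.closure_subset_iff.2 Set.sdiff_subset hx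
    · rintro rfl; exact hiso hx
  have hYk : IsCompact (X \ {a}) := hXk.of_isClosed_subset hYc Set.sdiff_subset
  have hbY : b ∈ X \ {a} := by
    refine ⟨⟨fun i => Set.right_mem_uIcc, fun i => ?_⟩, fun h => hne h.symm⟩
    rw [hab]; simp
  obtain ⟨y, hy, hmin⟩ := hYk.exists_isMinOn ⟨b, hbY⟩
    (f := fun x : n → ℝ => ∑ i, |x i - a i|) (by fun_prop)
  obtain ⟨k, hk, hkd⟩ := aux_direction (F' y) (h2 y hy.1.1) (fun i => y i - a i)
  let d : n → ℝ := fun i => y i - a i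
  let z : ℝ → (n → ℝ) := fun t i => y i - t * (k i * d i)
  have hz0 : z 0 = y := by ext i; simp [z]
  have hzd : HasDerivAt z (-(fun i => k i * d i)) 0 := by
    rw [hasDerivAt_pi]
    intro i
    have := ((hasDerivAt_id (0 : ℝ)).mul_const (k i * d i)).const_sub (y i)
    simpa using this
  have hFz : HasDerivAt (fun t => F (z t)) (-(F' y *ᵥ (fun i => k i * d i))) 0 := by
    have hFy := hF y
    rw [← hz0] at hFy
    have := hFy.comp_hasDerivAt (0 : ℝ) hzd
    rw [hz0] at this
    simpa [mulVec_neg, Function.comp_def] using this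
  have ev1 : ∀ i, ∀ᶠ t in 𝓝[>] (0 : ℝ), d i * (F (z t) i - F a i) ≤ 0 := by
    intro i
    by_cases hdi : d i = 0
    · simp [hdi]
    have hdF : HasDerivAt (fun t => d i * (F (z t) i - F y i))
        (d i * (-(F' y *ᵥ (fun i => k i * d i)) i)) 0 := by
      have := (hasDerivAt_pi.1 hFz i)
      exact (this.sub_const (F y i)).const_mul (d i)
    have hlt : d i * (-(F' y *ᵥ (fun i => k i * d i)) i) < 0 := by
      have := hkd i hdi
      simp only [d] at *
      linarith
    have hsl := hdF.hasDerivWithinAt (s := Set.Ioi 0)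
    have hsl' : ∀ᶠ t in 𝓝[>] (0 : ℝ), slope (fun t => d i * (F (z t) i - F y i)) 0 t < 0 := by
      have hh : Set.Ioi (0 : ℝ) \ {0} = Set.Ioi 0 := by
        ext t; simp only [Set.mem_sdiff, Set.mem_Ioi, Set.mem_singleton_iff]
        exact ⟨fun h => h.1, fun h => ⟨h, ne_of_gt h⟩⟩
      rw [hasDerivWithinAt_iff_tendsto_slope, hh] at hsl
      exact hsl.eventually_lt_const hlt
    filter_upwards [hsl', self_mem_nhdsWithin] with t ht htp
    rw [slope_def_field, hz0] at ht
    simp only [sub_self, mul_zero, sub_zero] at ht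
    have ht0 : 0 < t := htp
    have h6 : d i * (F (z t) i - F y i) < 0 := by
      by_contra hc
      push Not at hc
      exact absurd (div_nonneg hc ht0.le) (not_le.2 ht)
    have h7 : d i * (F y i - F a i) ≤ 0 := hy.1.2 i
    linarith
  have ev2 : ∀ i, ∀ᶠ t in 𝓝[>] (0 : ℝ), t * k i < 1 := by
    intro i
    have : Tendsto (fun t : ℝ => t * k i) (𝓝[>] 0) (𝓝 0) := by
      have : Tendsto (fun t : ℝ => t * k i) (𝓝 0) (𝓝 (0 * k i)) :=
        (continuous_id.mul continuous_const).tendsto 0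
      rw [zero_mul] at this
      exact this.mono_left nhdsWithin_le_nhds
    exact this.eventually_lt_const one_pos
  obtain ⟨t, ht1, ht2, ht0⟩ := ((eventually_all.2 ev1).and
    ((eventually_all.2 ev2).and self_mem_nhdsWithin)).exists
  have ht0 : 0 < t := ht0
  have hzi : ∀ i, z t i - a i = (1 - t * k i) * d i := by
    intro i; simp only [z, d]; ring
  have hc1 : ∀ i, 0 < 1 - t * k i := fun i => by linarith [ht2 i]
  have hc2 : ∀ i, 1 - t * k i < 1 := fun i => by linarith [mul_pos ht0 (hk i)]
  obtain ⟨i₀, hi₀⟩ : ∃ i, d i ≠ 0 := by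
    by_contra hc
    push Not at hc
    exact hy.2 (funext fun i => by simpa [d, sub_eq_zero] using hc i)
  have hzX : z t ∈ X \ {a} := by
    refine ⟨⟨fun i => ?_, fun i => ?_⟩, fun h => ?_⟩
    · have h3 := hy.1.1 i
      have h4 : z t i = a i + (1 - t * k i) * (y i - a i) := by
        have := hzi i; simp only [d] at this; linarith
      rw [h4]
      have c1 := hc1 i
      have c2 := hc2 i
      rw [Set.mem_uIcc] at h3 ⊢
      rcases h3 with ⟨p, q⟩ | ⟨p, q⟩
      · left; constructor <;> nlinarith
      · right; constructor <;> nlinarith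
    · rw [hzi, mul_assoc]
      exact mul_nonpos_of_nonneg_of_nonpos (hc1 i).le (ht1 i)
    · have h3 := hzi i₀
      rw [Set.mem_singleton_iff.1 h, sub_self] at h3
      exact (mul_ne_zero (hc1 i₀).ne' hi₀) h3.symm
  have hle : ∑ i, |y i - a i| ≤ ∑ i, |z t i - a i| := hmin hzX
  have hlt : ∑ i, |z t i - a i| < ∑ i, |y i - a i| := by
    refine Finset.sum_lt_sum (fun i _ => ?_) ⟨i₀, Finset.mem_univ _, ?_⟩
    · rw [hzi, abs_mul, abs_of_pos (hc1 i)]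
      exact mul_le_of_le_one_left (abs_nonneg _) (hc2 i).le
    · rw [hzi, abs_mul, abs_of_pos (hc1 i₀)]
      exact mul_lt_of_lt_one_left (abs_pos.2 hi₀) (hc2 i₀)
  linarith

namespace MultiCommoditySystem

variable {N C : ℕ} (S : MultiCommoditySystem N C)

theorem aux_diff_g (k i : Fin N) (hE : (k, i) ∈ S.E) (l : Fin C) :
    Differentiable ℝ (fun q : Fin N × Fin C → ℝ =>
      S.g k i l (fun c => q (k, c)) (fun c => q (i, c))) := by
  have h := (S.g_contDiff (k, i) hE l).differentiable one_ne_zero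
  have h2 : Differentiable ℝ (fun q : Fin N × Fin C → ℝ =>
      ((fun c => q (k, c), fun c => q (i, c)) : (Fin C → ℝ) × (Fin C → ℝ))) := by fun_prop
  exact h.comp h2

theorem aux_diff_gT (i : Fin N) (l : Fin C) :
    Differentiable ℝ (fun q : Fin N × Fin C → ℝ => S.gT i l (fun c => q (i, c))) := by
  have h := (S.gT_contDiff i l).differentiable one_ne_zero
  have h2 : Differentiable ℝ (fun q : Fin N × Fin C → ℝ => (fun c => q (i, c))) := by fun_prop
  exact h.comp h2

theorem aux_diff_f (i : Fin N) (l : Fin C) :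
    Differentiable ℝ (fun q : Fin N × Fin C → ℝ => S.f q i l) := by
  unfold f
  refine ((Differentiable.add (differentiable_const _) ?_).sub ?_).sub (S.aux_diff_gT i l)
  · exact Differentiable.fun_sum fun k hk => S.aux_diff_g k i (Finset.mem_filter.1 hk).2 l
  · exact Differentiable.fun_sum fun k hk => S.aux_diff_g i k (Finset.mem_filter.1 hk).2 l

theorem aux_diff_update {G : (Fin N × Fin C → ℝ) → ℝ} (hG : Differentiable ℝ G)
    (q : Fin N × Fin C → ℝ) (v : Fin N × Fin C) (x : ℝ) :
    DifferentiableAt ℝ (fun x => G (Function.update q v x)) x :=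
  (hG _).comp x (hasDerivAt_update q v x).differentiableAt

theorem aux_jac (q : Fin N × Fin C → ℝ) (a v : Fin N × Fin C) :
    S.jacobian q a v = fderiv ℝ (fun q => S.f q a.1 a.2) q (Pi.single v 1) := by
  have h := (S.aux_diff_f a.1 a.2 (Function.update q v (q v))).hasFDerivAt.comp_hasDerivAt (q v)
    (hasDerivAt_update q v (q v))
  rw [Function.update_eq_self] at h
  exact h.deriv

theorem aux_hasFDerivAt (q : Fin N × Fin C → ℝ) :
    HasFDerivAt (fun q (a : Fin N × Fin C) => - S.f q a.1 a.2)
      (LinearMap.toContinuousLinearMap (-(S.jacobian q)).mulVecLin) q := by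
  rw [hasFDerivAt_pi']
  intro a
  have h := ((S.aux_diff_f a.1 a.2) q).hasFDerivAt.neg
  refine h.congr_fderiv ?_
  refine ContinuousLinearMap.ext fun u => ?_
  symm
  have h2 := LinearMap.pi_apply_eq_sum_univ
    ((fderiv ℝ (fun q => S.f q a.1 a.2) q : _ →L[ℝ] ℝ) : (Fin N × Fin C → ℝ) →ₗ[ℝ] ℝ) u
  have h3 : ∀ j : Fin N × Fin C,
      (fun j' => if j = j' then (1 : ℝ) else 0) = Pi.single j 1 := by
    intro j; ext j'; simp [Pi.single_apply, eq_comm]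
  simp only [ContinuousLinearMap.coe_coe, h3, ← aux_jac] at h2
  change (-(S.jacobian q)).mulVec u a = -(fderiv ℝ (fun q => S.f q a.1 a.2) q u)
  rw [h2]
  simp [Matrix.neg_mulVec, Matrix.mulVec, dotProduct, mul_comm]

theorem aux_upd_same (q : Fin N × Fin C → ℝ) (j : Fin N) (l : Fin C) (x : ℝ) :
    (fun c => Function.update q (j, l) x (j, c)) = Function.update (fun c => q (j, c)) l x := by
  ext c
  by_cases h : c = l
  · subst h; simp
  · rw [Function.update_of_ne h, Function.update_of_ne (by simp [h])]

theorem aux_upd_ne (q : Fin N × Fin C → ℝ) (i j : Fin N) (h : i ≠ j) (l : Fin C) (x : ℝ) :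
    (fun c => Function.update q (j, l) x (i, c)) = fun c => q (i, c) := by
  ext c
  rw [Function.update_of_ne (by simp [h])]

theorem aux_off (q : Fin N × Fin C → ℝ) (hM : S.MMatrixCond q) (l : Fin C) (i j : Fin N)
    (hij : i ≠ j) : 0 ≤ S.jacobian q (i, l) (j, l) := by
  unfold jacobian
  have d1 : ∀ k ∈ Finset.univ.filter fun k => (k, i) ∈ S.E, DifferentiableAt ℝ
      (fun x => S.g k i l (fun c => Function.update q (j, l) x (k, c))
        (fun c => Function.update q (j, l) x (i, c))) (q (j, l)) := fun k hk =>
    aux_diff_update (S.aux_diff_g k i (Finset.mem_filter.1 hk).2 l) q (j, l) _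
  have d2 : ∀ k ∈ Finset.univ.filter fun k => (i, k) ∈ S.E, DifferentiableAt ℝ
      (fun x => S.g i k l (fun c => Function.update q (j, l) x (i, c))
        (fun c => Function.update q (j, l) x (k, c))) (q (j, l)) := fun k hk =>
    aux_diff_update (S.aux_diff_g i k (Finset.mem_filter.1 hk).2 l) q (j, l) _
  have d3 := aux_diff_update (S.aux_diff_gT i l) q (j, l) (q (j, l))
  have hd := (((HasDerivAt.fun_sum fun k hk => (d1 k hk).hasDerivAt).const_add (S.lam i l)).sub
    (HasDerivAt.fun_sum fun k hk => (d2 k hk).hasDerivAt)).sub d3.hasDerivAt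
  have he := hd.deriv
  have hee : deriv (fun x => S.f (Function.update q (j, l) x) i l) (q (j, l)) = _ := he
  rw [show (fun x => S.f (Function.update q (j, l) x) (i, l).1 (i, l).2)
    = (fun x => S.f (Function.update q (j, l) x) i l) from rfl, hee]
  have t3 : deriv (fun x => S.gT i l (fun c => Function.update q (j, l) x (i, c))) (q (j, l))
      = 0 := by
    simp only [aux_upd_ne q i j hij l, deriv_const]
  rw [t3, sub_zero, sub_nonneg]
  refine (Finset.sum_nonpos fun k hk => ?_).trans (Finset.sum_nonneg fun k hk => ?_)
  · by_cases hk' : k = j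
    · subst hk'
      simp only [aux_upd_ne q i k hij l, aux_upd_same]
      exact (((hM l).1 (i, k) (Finset.mem_filter.1 hk).2).2).le
    · simp only [aux_upd_ne q i j hij l, aux_upd_ne q k j hk' l, deriv_const]
      exact le_rfl
  · by_cases hk' : k = j
    · subst hk'
      simp only [aux_upd_ne q i k hij l, aux_upd_same]
      exact (((hM l).1 (k, i) (Finset.mem_filter.1 hk).2).1).le
    · simp only [aux_upd_ne q i j hij l, aux_upd_ne q k j hk' l, deriv_const]
      exact le_rfl

theorem aux_sum_f (q : Fin N × Fin C → ℝ) (l : Fin C) :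
    ∑ i, S.f q i l = ∑ i, S.lam i l - ∑ i, S.gT i l (fun c => q (i, c)) := by
  unfold f
  rw [Finset.sum_sub_distrib, Finset.sum_sub_distrib, Finset.sum_add_distrib]
  have : ∑ i, ∑ k ∈ Finset.univ.filter fun k => (k, i) ∈ S.E,
        S.g k i l (fun c => q (k, c)) (fun c => q (i, c))
      = ∑ i, ∑ j ∈ Finset.univ.filter fun j => (i, j) ∈ S.E,
        S.g i j l (fun c => q (i, c)) (fun c => q (j, c)) := by
    refine Finset.sum_comm' ?_
    intro a b; simp
  rw [this]; ring

theorem aux_col (q : Fin N × Fin C → ℝ) (hM : S.MMatrixCond q) (l : Fin C) (j : Fin N) :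
    ∑ i, S.jacobian q (i, l) (j, l) ≤ 0 := by
  unfold jacobian
  rw [← deriv_fun_sum (fun i _ => aux_diff_update (S.aux_diff_f i l) q (j, l) _)]
  simp only [aux_sum_f]
  have : ∀ x, ∑ i, S.gT i l (fun c => Function.update q (j, l) x (i, c))
      = S.gT j l (Function.update (fun c => q (j, c)) l x)
        + ∑ i ∈ Finset.univ.erase j, S.gT i l (fun c => q (i, c)) := by
    intro x
    rw [← Finset.add_sum_erase _ _ (Finset.mem_univ j), aux_upd_same]
    congr 1
    refine Finset.sum_congr rfl fun i hi => ?_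
    rw [aux_upd_ne q i j (Finset.ne_of_mem_erase hi)]
  simp only [this]
  rw [deriv_const_sub, deriv_add_const]
  linarith [(hM l).2.1 j]

theorem aux_main (q : Fin N × Fin C → ℝ) (hD : S.BlockDiagDominant q) (hM : S.MMatrixCond q) :
    (∀ x : Fin N × Fin C → ℂ, (∀ a, x a = 0 ∨ ∃ w : ℂ, w.re ≤ 0 ∧
      ((-(S.jacobian q)).map (fun a : ℝ => (a : ℂ))).mulVec x a = w * x a) → x = 0) ∧
    (∀ x : Fin N × Fin C → ℂ, (∀ a, x a = 0 ∨ ∃ w : ℂ, w.re ≤ 0 ∧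
      ((-(S.jacobian q)).transpose.map (fun a : ℝ => (a : ℂ))).mulVec x a = w * x a) →
        x = 0) := by
  have eb : ∀ p l, auxBlock (-(S.jacobian q)) p l = -(S.block q p l) := by
    intro p l; ext i j; simp [auxBlock, block]
  have ebt : ∀ p l, auxBlock (-(S.jacobian q)).transpose p l = (-(S.block q l p)).transpose := by
    intro p l; ext i j; simp [auxBlock, block]
  have hpos : ∀ l, 0 < sigmaMin (-(S.block q l l)) := by
    intro l
    rw [aux_sigmaMin_neg]
    exact (Finset.sum_nonneg fun p _ => Real.sqrt_nonneg _).trans_lt (hD l)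
  have hg := fun l => aux_good (-(S.block q l l)) (hpos l)
    (fun i j hij => by
      have := S.aux_off q hM l i j hij
      simpa [block] using this)
    (fun j => by
      have := S.aux_col q hM l j
      simpa [block] using this)
  refine ⟨aux_block_col _ (fun l => sigmaMin (-(S.block q l l))) (fun p => ?_) (fun l => ?_),
    aux_block_row _ (fun l => sigmaMin (-(S.block q l l))) (fun p => ?_) (fun l => ?_)⟩
  · rw [eb]; exact (hg p).1
  · simp only [eb, aux_sigmaMax_neg, aux_sigmaMin_neg]; exact hD l
  · rw [ebt]; exact (hg p).2
  · simp only [ebt, aux_sigmaMax_transpose, aux_sigmaMax_neg, aux_sigmaMin_neg]; exact hD l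

end MultiCommoditySystem

/-- **Theorem 4.**  Suppose that at every feasible point the Jacobian of the
multi-commodity dynamics satisfies block strict diagonal dominance and the
M-matrix condition.  Then the system has at most one equilibrium point, and
at any equilibrium point every eigenvalue of the Jacobian has strictly
negative real part. -/
theorem stmt5 {N C : ℕ} (S : MultiCommoditySystem N C)
    (h : ∀ q, S.Feasible q → S.BlockDiagDominant q ∧ S.MMatrixCond q) :
    (∀ q q', S.Feasible q → S.Feasible q' →
      (∀ i ℓ, S.f q i ℓ = 0) → (∀ i ℓ, S.f q' i ℓ = 0) → q = q') ∧
    (∀ q, S.Feasible q → (∀ i ℓ, S.f q i ℓ = 0) →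
      ∀ z : ℂ, ((S.jacobian q).map (fun x : ℝ => (x : ℂ))).charpoly.IsRoot z →
        z.re < 0) := by
  refine ⟨?_, ?_⟩
  · intro q q' hq hq' h0 h0'
    have hfeas : ∀ x : Fin N × Fin C → ℝ, (∀ a, x a ∈ Set.uIcc (q a) (q' a)) → S.Feasible x := by
      intro x hx i l
      have h1 := hx (i, l)
      rw [Set.mem_uIcc] at h1
      obtain ⟨a1, a2⟩ := hq i l
      obtain ⟨b1, b2⟩ := hq' i l
      rcases h1 with ⟨c1, c2⟩ | ⟨c1, c2⟩
      · exact ⟨a1.trans c1, (EReal.coe_le_coe_iff.2 c2).trans b2⟩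
      · exact ⟨b1.trans c1, (EReal.coe_le_coe_iff.2 c2).trans a2⟩
    refine aux_gale_nikaido (fun q (a : Fin N × Fin C) => - S.f q a.1 a.2)
      (fun q => -(S.jacobian q)) q q' S.aux_hasFDerivAt ?_ ?_ ?_
    · intro x hx
      obtain ⟨hD, hM⟩ := h x (hfeas x hx)
      exact aux_real _ (S.aux_main x hD hM).1
    · intro x hx
      obtain ⟨hD, hM⟩ := h x (hfeas x hx)
      exact aux_real _ (S.aux_main x hD hM).2
    · ext a
      simp [h0, h0']
  · intro q hq _ z hz
    by_contra hre
    push Not at hre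
    obtain ⟨hD, hM⟩ := h q hq
    rw [← Matrix.mem_spectrum_iff_isRoot_charpoly, ← Matrix.spectrum_toLin',
      ← Module.End.hasEigenvalue_iff_mem_spectrum] at hz
    obtain ⟨x, hx⟩ := hz.exists_hasEigenvector
    refine hx.2 ((S.aux_main q hD hM).1 x fun a => Or.inr ⟨-z, by simpa using hre, ?_⟩)
    have h1 := congrFun hx.apply_eq_smul a
    rw [Matrix.toLin'_apply, Pi.smul_apply, smul_eq_mul] at h1
    rw [neg_mul, ← h1]
    simp [Matrix.mulVec, dotProduct]
end
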